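/- For all integers m, n, t > 0 there is a bijection φ from the set F(m,n,t) of pairs (P, A), where P ∈ D(m,n,t) and A is a subset of the set of valleys of P, onto the set S(m,n,t) of small (m,t)-Schröder paths of height n, such that whenever φ(P,A) = S one has val(P) = val(S) + dg(S) and ret(P) = ret(S) + cd(S); moreover, φ(P,A) is m-divisible if and only if A is a subset of the set of m-valleys of P. -/

import Mathlib

/-- A step of a lattice path: north `(0,1)`, east `(1,0)` or diagonal `(1,1)`. -/
inductive Step : Type
  | N : Step
  | E : Step
  | D : Step
  deriving DecidableEq

/-- The displacement vector of a step. -/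
def stepVec : Step → ℤ × ℤ
  | .N => (0, 1)
  | .E => (1, 0)
  | .D => (1, 1)

/-- The lattice point reached after the first `k` steps of the path `P` (starting at the
origin). -/
def pt (P : List Step) (k : ℕ) : ℤ × ℤ := ((P.take k).map stepVec).sum

/-- The path `P` starts with at least `t` north steps. -/
def StartsNorth (t : ℤ) (P : List Step) : Prop := List.replicate t.toNat Step.N <+: P

/-- The path `P` stays weakly above the line `x = m·y`. -/
def AboveLine (m : ℤ) (P : List Step) : Prop := ∀ k : ℕ, (pt P k).1 ≤ m * (pt P k).2

/-- An `(m,t)`-Schröder path of height `n`: a lattice path from `(0,0)` to `(mn,n)` using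
north, east and diagonal steps, starting with at least `t` north steps and never going
below the line `x = m·y`. -/
def IsSchroeder (m n t : ℤ) (P : List Step) : Prop :=
  StartsNorth t P ∧ pt P P.length = (m * n, n) ∧ AboveLine m P

/-- An `(m,t)`-Dyck path of height `n`: an `(m,t)`-Schröder path of height `n` with no
diagonal steps. -/
def IsDyck (m n t : ℤ) (P : List Step) : Prop :=
  IsSchroeder m n t P ∧ ∀ s ∈ P, s ≠ Step.D

/-- A Schröder path is small if none of its diagonal steps starts on the line `x = m·y`. -/
def IsSmall (m : ℤ) (P : List Step) : Prop :=
  ∀ j : ℕ, P[j]? = some Step.D → (pt P j).1 ≠ m * (pt P j).2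

/-- A Schröder path is positive if it touches the line `x = m·y` only at its two
endpoints. -/
def IsPositive (m : ℤ) (P : List Step) : Prop :=
  ∀ k : ℕ, 0 < k → k < P.length → (pt P k).1 ≠ m * (pt P k).2

/-- The set of indices `j` such that the `j`-th step of `P` is east and the `(j+1)`-st is
north; the corresponding valley point is `pt P (j+1)`. -/
def valleys (P : List Step) : Finset ℕ :=
  (Finset.range P.length).filter fun j => P[j]? = some Step.E ∧ P[j + 1]? = some Step.N

/-- The number of valleys of `P`. -/
def val (P : List Step) : ℕ := (valleys P).card

/-- The number of valleys of `P` whose `x`-coordinate is congruent to `i` modulo `m`. -/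
def ival (m i : ℤ) (P : List Step) : ℕ :=
  ((valleys P).filter fun j => (pt P (j + 1)).1 % m = i % m).card

/-- The set of returns of `P`: valleys of the form `(m·i, i)`. -/
def returns (m : ℤ) (P : List Step) : Finset ℕ :=
  (valleys P).filter fun j => (pt P (j + 1)).1 = m * (pt P (j + 1)).2

/-- The number of returns of `P`. -/
def ret (m : ℤ) (P : List Step) : ℕ := (returns m P).card

/-- The set of indices of diagonal steps of `P`. -/
def diags (P : List Step) : Finset ℕ :=
  (Finset.range P.length).filter fun j => P[j]? = some Step.D

/-- The number of diagonal steps of `P`. -/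
def dg (P : List Step) : ℕ := (diags P).card

/-- A Schröder path is `m`-divisible if every diagonal step ends at an `x`-coordinate
divisible by `m`. -/
def MDivisible (m : ℤ) (P : List Step) : Prop :=
  ∀ j ∈ diags P, m ∣ (pt P (j + 1)).1

/-- The number of cornered diagonal steps of `P`: diagonal steps connecting `(i·m − 1, i)`
to `(i·m, i + 1)` for some `i`. -/
def cd (m : ℤ) (P : List Step) : ℕ :=
  ((diags P).filter fun j => (pt P (j + 1)).1 = m * ((pt P (j + 1)).2 - 1)).card

/-- The generalized binomial coefficient `C(p,q) = p(p−1)⋯(p−q+1)/q!` for integers `p` and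
`q ≥ 0`, and `C(p,q) = 0` for `q < 0`. -/
def C (p q : ℤ) : ℤ :=
  if q < 0 then 0
  else if 0 ≤ p then (p.toNat.choose q.toNat : ℤ)
  else (-1) ^ q.toNat * ((q - p - 1).toNat.choose q.toNat : ℤ)

/-- Replace every diagonal step of a path by an east step followed by a north step. -/
def expand : List Step → List Step
  | [] => []
  | .N :: S => .N :: expand S
  | .E :: S => .E :: expand S
  | .D :: S => .E :: .N :: expand S

/-- The indices in `expand S` of the valleys that come from diagonal steps of `S`. -/
def marks : List Step → Finset ℕ
  | [] => ∅
  | .N :: S => (marks S).image (· + 1)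
  | .E :: S => (marks S).image (· + 1)
  | .D :: S => insert 0 ((marks S).image (· + 2))

theorem pt_zero (P : List Step) : pt P 0 = 0 := by simp [pt]

theorem pt_cons_succ (a : Step) (P : List Step) (k : ℕ) :
    pt (a :: P) (k + 1) = stepVec a + pt P k := by simp [pt]

theorem pt_length (P : List Step) : pt P P.length = (P.map stepVec).sum := by simp [pt]

theorem mem_valleys {P : List Step} {j : ℕ} :
    j ∈ valleys P ↔ P[j]? = some Step.E ∧ P[j + 1]? = some Step.N := by
  simp only [valleys, Finset.mem_filter, Finset.mem_range, and_iff_right_iff_imp]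
  rintro ⟨h, -⟩
  exact (List.getElem?_eq_some_iff.1 h).1

theorem mem_diags {P : List Step} {j : ℕ} : j ∈ diags P ↔ P[j]? = some Step.D := by
  simp only [diags, Finset.mem_filter, Finset.mem_range, and_iff_right_iff_imp]
  intro h
  exact (List.getElem?_eq_some_iff.1 h).1

theorem sum_stepVec_expand (S : List Step) :
    ((expand S).map stepVec).sum = (S.map stepVec).sum := by
  induction S with
  | nil => rfl
  | cons a S ih => cases a <;> simp [expand, ih, stepVec, ← add_assoc]

theorem ne_D_of_mem_expand (S : List Step) : ∀ s ∈ expand S, s ≠ Step.D := by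
  induction S with
  | nil => simp [expand]
  | cons a S ih => cases a <;> simpa [expand] using ih

theorem getElem?_zero_expand_eq_N (S : List Step) :
    (expand S)[0]? = some Step.N ↔ S[0]? = some Step.N := by
  rcases S with _ | ⟨_ | _ | _, S⟩ <;> simp [expand]

theorem replicate_N_prefix_expand (k : ℕ) (S : List Step) :
    List.replicate k Step.N <+: expand S ↔ List.replicate k Step.N <+: S := by
  induction k generalizing S with
  | zero => simp
  | succ k ih =>
    rcases S with _ | ⟨_ | _ | _, S⟩ <;>
      simp [expand, List.replicate_succ, List.cons_prefix_cons, ih]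

theorem forall_pt_cons (Q : ℤ × ℤ → Prop) (a : Step) (P : List Step) :
    (∀ k, Q (pt (a :: P) k)) ↔ Q 0 ∧ ∀ k, Q (stepVec a + pt P k) := by
  refine ⟨fun h => ⟨pt_zero (a :: P) ▸ h 0, fun k => pt_cons_succ a P k ▸ h (k + 1)⟩, ?_⟩
  rintro ⟨h0, h⟩ (_ | k)
  · rwa [pt_zero]
  · rw [pt_cons_succ]; exact h k

theorem forall_diag_cons (Q : ℤ × ℤ → Prop) (a : Step) (P : List Step) :
    (∀ j, (a :: P)[j]? = some Step.D → Q (pt (a :: P) j)) ↔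
      (a = Step.D → Q 0) ∧ ∀ j, P[j]? = some Step.D → Q (stepVec a + pt P j) := by
  constructor
  · intro h
    refine ⟨fun ha => ?_, fun j hj => ?_⟩
    · simpa [pt_zero] using h 0 (by simp [ha])
    · simpa [pt_cons_succ] using h (j + 1) (by simpa using hj)
  · rintro ⟨h0, h⟩ (_ | j) hj
    · rw [pt_zero]; exact h0 (by simpa using hj)
    · rw [pt_cons_succ]; exact h j (by simpa using hj)

theorem forall_add_pt_expand_le (m : ℤ) (S : List Step) (p : ℤ × ℤ) :
    (∀ k, (p + pt (expand S) k).1 ≤ m * (p + pt (expand S) k).2) ↔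
      (∀ k, (p + pt S k).1 ≤ m * (p + pt S k).2) ∧
        ∀ j, S[j]? = some Step.D → (p + pt S j).1 ≠ m * (p + pt S j).2 := by
  induction S generalizing p with
  | nil => simp [expand]
  | cons a S ih =>
    rw [forall_pt_cons (fun v => (p + v).1 ≤ m * (p + v).2) a S,
      forall_diag_cons (fun v => (p + v).1 ≠ m * (p + v).2) a S]
    cases a
    case D =>
      have hE : (p + stepVec .E).1 ≤ m * (p + stepVec .E).2 ↔ p.1 < m * p.2 := by
        simp [stepVec]
      have hD : p + (stepVec .E + stepVec .N) = p + stepVec .D := by simp [stepVec]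
      rw [expand, forall_pt_cons (fun v => (p + v).1 ≤ m * (p + v).2),
        forall_pt_cons (fun v => (p + (stepVec .E + v)).1 ≤ m * (p + (stepVec .E + v)).2)]
      simp only [add_zero, ← add_assoc] at hD ⊢
      rw [hE, hD, ih, lt_iff_le_and_ne]
      tauto
    all_goals
      rw [expand, forall_pt_cons (fun v => (p + v).1 ≤ m * (p + v).2)]
      simp only [← add_assoc, ih]
      simp [and_assoc]

theorem aboveLine_expand (m : ℤ) (S : List Step) :
    AboveLine m (expand S) ↔ AboveLine m S ∧ IsSmall m S := by
  simpa [AboveLine, IsSmall] using forall_add_pt_expand_le m S 0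

theorem isDyck_expand (m n t : ℤ) (S : List Step) :
    IsDyck m n t (expand S) ↔ IsSchroeder m n t S ∧ IsSmall m S := by
  simp only [IsDyck, IsSchroeder, StartsNorth, replicate_N_prefix_expand, pt_length,
    sum_stepVec_expand, aboveLine_expand]
  have := ne_D_of_mem_expand S
  tauto

theorem succ_mem_valleys_cons (a : Step) (P : List Step) (j : ℕ) :
    j + 1 ∈ valleys (a :: P) ↔ j ∈ valleys P := by
  simp [mem_valleys]

theorem zero_mem_valleys_cons (a : Step) (P : List Step) :
    0 ∈ valleys (a :: P) ↔ a = Step.E ∧ P[0]? = some Step.N := by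
  simp [mem_valleys]

theorem marks_subset_valleys (S : List Step) : marks S ⊆ valleys (expand S) := by
  induction S with
  | nil => simp [marks]
  | cons a S ih =>
    cases a <;> intro j hj <;> rcases j with _ | _ | j <;>
      simp only [marks, expand, succ_mem_valleys_cons, zero_mem_valleys_cons, Finset.mem_image,
        Finset.mem_insert] at hj ⊢ <;> simp at hj ⊢ <;> exact ih hj

theorem card_eq_ite_zero_add {s s' : Finset ℕ} (h : ∀ j, j + 1 ∈ s ↔ j ∈ s') :
    s.card = (if 0 ∈ s then 1 else 0) + s'.card := by
  have hs : s = (if 0 ∈ s then {0} else ∅) ∪ s'.image (· + 1) := by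
    ext (_ | j)
    · by_cases h0 : 0 ∈ s <;> simp [h0]
    · by_cases h0 : 0 ∈ s <;> simp [h0, h]
  have hd : Disjoint (if 0 ∈ s then ({0} : Finset ℕ) else ∅) (s'.image (· + 1)) := by
    split <;> simp
  conv_lhs => rw [hs, Finset.card_union_of_disjoint hd,
    Finset.card_image_of_injective _ (add_left_injective 1)]
  split <;> simp

theorem card_filter_valleys_cons (a : Step) (P : List Step) (q : ℤ × ℤ → Prop)
    [DecidablePred q] :
    ((valleys (a :: P)).filter fun j => q (pt (a :: P) (j + 1))).card =
      (if (a = Step.E ∧ P[0]? = some Step.N) ∧ q (stepVec a) then 1 else 0) +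
        ((valleys P).filter fun j => q (stepVec a + pt P (j + 1))).card := by
  rw [card_eq_ite_zero_add (s' := (valleys P).filter fun j => q (stepVec a + pt P (j + 1)))]
  · simp only [Finset.mem_filter, zero_mem_valleys_cons, pt_cons_succ, pt_zero, add_zero]
  · intro j
    simp only [Finset.mem_filter, succ_mem_valleys_cons, pt_cons_succ]

theorem card_filter_diags_cons (a : Step) (P : List Step) (q : ℤ × ℤ → Prop)
    [DecidablePred q] :
    ((diags (a :: P)).filter fun j => q (pt (a :: P) (j + 1))).card =
      (if a = Step.D ∧ q (stepVec a) then 1 else 0) +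
        ((diags P).filter fun j => q (stepVec a + pt P (j + 1))).card := by
  rw [card_eq_ite_zero_add (s' := (diags P).filter fun j => q (stepVec a + pt P (j + 1)))]
  · simp [mem_diags, pt_cons_succ, pt_zero]
  · intro j
    simp [mem_diags, pt_cons_succ]

theorem card_filter_valleys_expand (S : List Step) (q : ℤ × ℤ → Prop) [DecidablePred q] :
    ((valleys (expand S)).filter fun j => q (pt (expand S) (j + 1))).card =
      ((valleys S).filter fun j => q (pt S (j + 1))).card +
        ((diags S).filter fun j => q (pt S (j + 1) - (0, 1))).card := by
  induction S generalizing q with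
  | nil => rfl
  | cons a S ih =>
    rw [card_filter_valleys_cons a S, card_filter_diags_cons a S (fun v => q (v - (0, 1)))]
    cases a
    case D =>
      have hD : stepVec .E + stepVec .N = stepVec .D := by simp [stepVec]
      have hE : stepVec .D - (0, 1) = stepVec .E := by simp [stepVec]
      rw [expand, card_filter_valleys_cons,
        card_filter_valleys_cons _ _ (fun v => q (stepVec .E + v))]
      simp only [← add_assoc, hD, hE, ih (fun v => q (stepVec .D + v)), add_sub_assoc]
      simp
      omega
    all_goals
      rw [expand, card_filter_valleys_cons, ih (fun v => q (stepVec _ + v))]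
      simp only [getElem?_zero_expand_eq_N, add_assoc, add_sub_assoc]
      simp

theorem forall_marks_iff (S : List Step) (q : ℤ × ℤ → Prop) :
    (∀ i ∈ marks S, q (pt (expand S) (i + 1))) ↔
      ∀ j ∈ diags S, q (pt S (j + 1) - (0, 1)) := by
  have hcons (a : Step) (P : List Step) (q : ℤ × ℤ → Prop) :
      (∀ j ∈ diags (a :: P), q (pt (a :: P) (j + 1))) ↔
        (a = Step.D → q (stepVec a)) ∧ ∀ j ∈ diags P, q (stepVec a + pt P (j + 1)) := by
    simp only [mem_diags, pt_cons_succ]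
    exact ⟨fun h => ⟨fun ha => by simpa [pt_zero] using h 0 (by simp [ha]),
      fun j hj => by simpa [pt_cons_succ] using h (j + 1) (by simpa using hj)⟩,
      fun ⟨h0, h⟩ j => by
        cases j with
        | zero => simpa [pt_zero] using h0
        | succ j => simpa [pt_cons_succ] using h j⟩
  induction S generalizing q with
  | nil => simp [marks, diags]
  | cons a S ih =>
    rw [hcons a S (fun v => q (v - (0, 1)))]
    cases a
    case D =>
      have hD : stepVec .E + stepVec .N = stepVec .D := by simp [stepVec]
      have hE : stepVec .D - (0, 1) = stepVec .E := by simp [stepVec]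
      simp only [marks, expand, Finset.forall_mem_insert, Finset.forall_mem_image, pt_cons_succ,
        pt_zero, add_zero, ← add_assoc, hD, hE, ih (fun v => q (stepVec .D + v)),
        add_sub_assoc, true_imp_iff]
    all_goals
      simp only [marks, expand, Finset.forall_mem_image, pt_cons_succ, add_sub_assoc]
      simpa using ih (fun v => q (stepVec _ + v))

theorem eq_of_expand_eq_of_marks_eq {S T : List Step} (h : expand S = expand T)
    (hm : marks S = marks T) : S = T := by
  have succ_inj (k : ℕ) : Function.Injective (Finset.image (· + k)) :=
    Finset.image_injective (add_left_injective k)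
  induction S generalizing T with
  | nil => rcases T with _ | ⟨_ | _ | _, T⟩ <;> simp [expand] at h ⊢
  | cons a S ih =>
    rcases T with _ | ⟨b, T⟩
    · cases a <;> simp [expand] at h
    · cases a <;> cases b <;> simp only [expand, List.cons.injEq, reduceCtorEq, true_and,
        false_and] at h <;> simp only [marks] at hm
      · rw [ih h (succ_inj 1 hm)]
      · rw [ih h (succ_inj 1 hm)]
      · have := Finset.ext_iff.1 hm 0
        simp at this
      · have := Finset.ext_iff.1 hm 0
        simp at this
      · rw [ih h (succ_inj 2 ?_)]
        have h0 (U : List Step) : 0 ∉ (marks U).image (· + 2) := by simp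
        rw [← Finset.erase_insert (h0 S), hm, Finset.erase_insert (h0 T)]

theorem exists_expand_eq_marks_eq (P : List Step) (hP : ∀ s ∈ P, s ≠ Step.D) (A : Finset ℕ)
    (hA : A ⊆ valleys P) : ∃ S, expand S = P ∧ marks S = A := by
  have pre (k j : ℕ) (A : Finset ℕ) :
      j ∈ A.preimage (· + k) (add_left_injective k).injOn ↔ j + k ∈ A := Finset.mem_preimage
  match P with
  | [] => exact ⟨[], rfl, by simpa [valleys, marks, eq_comm] using hA⟩
  | .D :: P => simp at hP
  | .N :: P =>
    obtain ⟨S, hS, hSA⟩ := exists_expand_eq_marks_eq P (fun s hs => hP s (by simp [hs]))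
      (A.preimage (· + 1) (add_left_injective 1).injOn)
      (fun j hj => (succ_mem_valleys_cons _ _ _).1 (hA ((pre 1 j A).1 hj)))
    refine ⟨.N :: S, by rw [expand, hS], ?_⟩
    ext (_ | j)
    · have : 0 ∉ A := fun h => by simpa [mem_valleys] using hA h
      simp [marks, this]
    · simp [marks, hSA]
  | .E :: P =>
    by_cases h0 : 0 ∈ A
    · match P with
      | [] => simpa [mem_valleys] using hA h0
      | .E :: P => simpa [mem_valleys] using hA h0
      | .D :: P => simp at hP
      | .N :: P =>
        obtain ⟨S, hS, hSA⟩ := exists_expand_eq_marks_eq P (fun s hs => hP s (by simp [hs]))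
          (A.preimage (· + 2) (add_left_injective 2).injOn)
          (fun j hj => (succ_mem_valleys_cons _ _ _).1
            ((succ_mem_valleys_cons _ _ _).1 (hA ((pre 2 j A).1 hj))))
        refine ⟨.D :: S, by rw [expand, hS], ?_⟩
        ext (_ | _ | j)
        · simp [marks, h0]
        · have : 1 ∉ A := fun h => by simpa [mem_valleys] using hA h
          simp [marks, this]
        · simp [marks, hSA]
    · obtain ⟨S, hS, hSA⟩ := exists_expand_eq_marks_eq P (fun s hs => hP s (by simp [hs]))
        (A.preimage (· + 1) (add_left_injective 1).injOn)
        (fun j hj => (succ_mem_valleys_cons _ _ _).1 (hA ((pre 1 j A).1 hj)))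
      refine ⟨.E :: S, by rw [expand, hS], ?_⟩
      ext (_ | j)
      · simp [marks, h0]
      · simp [marks, hSA]

theorem val_expand (S : List Step) : val (expand S) = val S + dg S := by
  simpa [val, dg] using card_filter_valleys_expand S (fun _ => True)

theorem ret_expand (m : ℤ) (S : List Step) : ret m (expand S) = ret m S + cd m S := by
  simpa [ret, cd, returns] using card_filter_valleys_expand S (fun v => v.1 = m * v.2)

theorem mDivisible_iff_marks_subset (m : ℤ) (S : List Step) :
    MDivisible m S ↔
      marks S ⊆ (valleys (expand S)).filter fun j => m ∣ (pt (expand S) (j + 1)).1 := by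
  have h := forall_marks_iff S (fun v => m ∣ v.1)
  simp only [Prod.fst_sub, sub_zero] at h
  rw [MDivisible, ← h]
  simp only [Finset.subset_iff, Finset.mem_filter]
  exact ⟨fun h i hi => ⟨marks_subset_valleys S hi, h i hi⟩, fun h i hi => (h hi).2⟩

/-- the bijection between `(m,t)`-Dyck paths with a marked subset of
valleys and small `(m,t)`-Schröder paths. -/
theorem statement16 (m n t : ℤ) (hm : 0 < m) (hn : 0 < n) (ht : 0 < t) :
    ∃ φ : {PA : List Step × Finset ℕ // IsDyck m n t PA.1 ∧ PA.2 ⊆ valleys PA.1} →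
          {S : List Step // IsSchroeder m n t S ∧ IsSmall m S},
      Function.Bijective φ ∧
      ∀ PA, val PA.val.1 = val (φ PA).val + dg (φ PA).val ∧
        ret m PA.val.1 = ret m (φ PA).val + cd m (φ PA).val ∧
        (MDivisible m (φ PA).val ↔
          PA.val.2 ⊆ (valleys PA.val.1).filter fun j => m ∣ (pt PA.val.1 (j + 1)).1) := by
  let ψ : {S : List Step // IsSchroeder m n t S ∧ IsSmall m S} →
      {PA : List Step × Finset ℕ // IsDyck m n t PA.1 ∧ PA.2 ⊆ valleys PA.1} :=
    fun S => ⟨(expand S.1, marks S.1), (isDyck_expand m n t S.1).2 S.2, marks_subset_valleys S.1⟩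
  have hψ : Function.Bijective ψ := by
    constructor
    · intro S T h
      have h' := Prod.ext_iff.1 (Subtype.ext_iff.1 h)
      exact Subtype.ext (eq_of_expand_eq_of_marks_eq h'.1 h'.2)
    · rintro ⟨⟨P, A⟩, hP, hA⟩
      obtain ⟨S, rfl, rfl⟩ := exists_expand_eq_marks_eq P hP.2 A hA
      exact ⟨⟨S, (isDyck_expand m n t S).1 hP⟩, rfl⟩
  refine ⟨(Equiv.ofBijective ψ hψ).symm, Equiv.bijective _, fun PA => ?_⟩
  obtain ⟨S, rfl⟩ := (Equiv.ofBijective ψ hψ).surjective PA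
  rw [Equiv.symm_apply_apply]
  exact ⟨val_expand S.1, ret_expand m S.1, mDivisible_iff_marks_subset m S.1⟩
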